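/- Let T and T' be two nonempty basic tiles on disjoint vertex sets, and assume it is not the case that T is an open simplex and T' a closed simplex. Then sd(T * T') carries a shelled h-tiling which begins with the derived neighborhood N(T, T * T') and which uses a critical tile if and only if T * T' is critical. Moreover, when T * T' is critical, the critical tile of the tiling is unique, isomorphic to T * T', and it belongs to N(T, T * T') if T * T' is a closed simplex while it lies outside N(T, T * T') if T * T' is an open simplex. -/

import Mathlib

/-!
Common combinatorial framework for Morse shellings of simplicial complexes,
following J.-Y. Welschinger, "Morse shellings out of discrete Morse functions".
-/

namespace MorseShelling

variable {V : Type*} [DecidableEq V] {W : Type*} [DecidableEq W]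

/-- A (finite, combinatorial) simplicial complex: a downward-closed collection of
finite subsets (simplices) of the vertex type. -/
def IsComplex (K : Finset (Finset V)) : Prop :=
  ∀ σ ∈ K, ∀ τ ⊆ σ, τ ∈ K

/-- A relative simplicial complex `S = K \ L`, recorded as the pair `(K, L)`. -/
structure RelCplx (V : Type*) where
  K : Finset (Finset V)
  L : Finset (Finset V)

/-- The faces of a relative simplicial complex. -/
def RelCplx.faces (S : RelCplx V) : Finset (Finset V) := S.K \ S.L

/-- Validity of a relative simplicial complex: both members are complexes and
`L` is a subcomplex of `K`. -/
def RelCplx.IsValid (S : RelCplx V) : Prop :=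
  IsComplex S.K ∧ IsComplex S.L ∧ S.L ⊆ S.K

/-- Join of two collections of faces (on disjoint vertex supports). -/
def joinF (K₁ K₂ : Finset (Finset V)) : Finset (Finset V) :=
  (K₁ ×ˢ K₂).image fun p => p.1 ∪ p.2

/-- Join of two relative simplicial complexes:
`(K₁ * K₂) \ ((L₁ * K₂) ∪ (K₁ * L₂))`. -/
def RelCplx.join (S₁ S₂ : RelCplx V) : RelCplx V :=
  ⟨joinF S₁.K S₂.K, joinF S₁.L S₂.K ∪ joinF S₁.K S₂.L⟩

/-- The star of a simplex `σ` in `K` : all faces `τ` with `σ ∪ τ ∈ K`. -/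
def star (K : Finset (Finset V)) (σ : Finset V) : Finset (Finset V) :=
  K.filter fun τ => σ ∪ τ ∈ K

/-- The link of a simplex `σ` in `K` : all faces `τ` of the star disjoint from `σ`. -/
def link (K : Finset (Finset V)) (σ : Finset V) : Finset (Finset V) :=
  K.filter fun τ => σ ∪ τ ∈ K ∧ σ ∩ τ = ∅

/-- The star of a simplex in a relative complex, `st_S(σ) = st_K(σ) \ st_L(σ)`. -/
def RelCplx.starR (S : RelCplx V) (σ : Finset V) : RelCplx V :=
  ⟨star S.K σ, star S.L σ⟩

/-- The link of a simplex in a relative complex, `lk_S(σ) = lk_K(σ) \ lk_L(σ)`. -/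
def RelCplx.linkR (S : RelCplx V) (σ : Finset V) : RelCplx V :=
  ⟨link S.K σ, link S.L σ⟩

/-- The boundary complex of a simplex: all its proper faces (including `∅`). -/
def boundary (σ : Finset V) : Finset (Finset V) := σ.powerset.erase σ

/-- First barycentric subdivision: the faces are the (possibly empty) flags
`∅ ≠ σ₀ ⊊ σ₁ ⊊ ... ⊊ σ_q` of nonempty faces of `K`, a nonempty face `σ` of `K`
becoming the vertex `σ̂ = σ`. By convention `sd ∅ = ∅`. -/
def sd (K : Finset (Finset V)) : Finset (Finset (Finset V)) :=
  if K = ∅ then ∅ else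
    (K.erase ∅).powerset.filter fun c => ∀ a ∈ c, ∀ b ∈ c, a ⊆ b ∨ b ⊆ a

/-- First barycentric subdivision of a relative complex: `sd (K \ L) = sd K \ sd L`. -/
def RelCplx.sdR (S : RelCplx V) : RelCplx (Finset V) := ⟨sd S.K, sd S.L⟩

/-- An (absolute) simplicial complex seen as a relative one. -/
def toRel (K : Finset (Finset V)) : RelCplx V := ⟨K, ∅⟩

/-- The vertex support of a relative complex. -/
def suppK (S : RelCplx V) : Finset V := S.K.sup id

/-- The ridges (codimension one faces) of a simplex. -/
def ridges (σ : Finset V) : Finset (Finset V) := σ.image fun v => σ.erase v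

/-- The subcomplex of the simplex `σ` consisting of the faces contained in some
member of `R`. -/
def below (σ : Finset V) (R : Finset (Finset V)) : Finset (Finset V) :=
  σ.powerset.filter fun τ => ∃ ρ ∈ R, τ ⊆ ρ

/-- The restriction set of the basic tile `σ \ R`: the face spanned by the
vertices opposite to the missing ridges `R`. -/
def restSet (σ : Finset V) (R : Finset (Finset V)) : Finset V :=
  σ.filter fun v => σ.erase v ∈ R

/-- A basic tile of dimension `n` and order `k`: an `n`-simplex deprived of `k`
of its ridges (together with all the faces contained in them). -/
def IsBasicTile (S : RelCplx V) (n k : ℕ) : Prop :=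
  ∃ σ : Finset V, σ.card = n + 1 ∧ S.K = σ.powerset ∧
    ∃ R ⊆ ridges σ, R.card = k ∧ S.L = below σ R

/-- A Morse tile of dimension `n` and order `k`: a basic tile, possibly further
deprived of a unique face of higher codimension (its Morse face). -/
def IsMorseTile (S : RelCplx V) (n k : ℕ) : Prop :=
  ∃ σ : Finset V, σ.card = n + 1 ∧ S.K = σ.powerset ∧
    ∃ R ⊆ ridges σ, R.card = k ∧
      (S.L = below σ R ∨
        ∃ μ ⊆ σ, μ ∉ below σ R ∧ μ.card + 2 ≤ σ.card ∧
          S.L = below σ R ∪ below σ {μ})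

/-- A critical tile of dimension `n` and index `k`: either a closed simplex
(index `0`), or a basic tile of order `k` deprived of its restriction set
(this includes the dotted simplex for `k = 0` and the open simplex for `k = n`). -/
def IsCriticalTile (S : RelCplx V) (n k : ℕ) : Prop :=
  ∃ σ : Finset V, σ.card = n + 1 ∧ S.K = σ.powerset ∧
    ((k = 0 ∧ S.L = ∅) ∨
      (k ≤ n ∧ ∃ R ⊆ ridges σ, R.card = k ∧
        S.L = below σ R ∪ below σ {restSet σ R}))

/-- A closed simplex, as a tile. -/
def IsClosedSimplexTile (S : RelCplx V) : Prop :=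
  ∃ σ : Finset V, S.K = σ.powerset ∧ S.L = ∅

/-- An open simplex, as a tile: deprived of its whole boundary, incl. the empty face. -/
def IsOpenSimplexTile (S : RelCplx V) : Prop :=
  ∃ σ : Finset V, σ ≠ ∅ ∧ S.K = σ.powerset ∧ S.L = σ.powerset.erase σ

/-- The closed simplex on vertex set `σ`, as a relative complex. -/
def closedT (σ : Finset V) : RelCplx V := ⟨σ.powerset, ∅⟩

/-- The open simplex on vertex set `σ`. -/
def openT (σ : Finset V) : RelCplx V := ⟨σ.powerset, σ.powerset.erase σ⟩

/-- The closed simplex deprived of its empty face, `σ̇` (the neutral tile when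
`σ = ∅`, so that empty factors may be dropped from joins). -/
def dotT (σ : Finset V) : RelCplx V := ⟨σ.powerset, if σ = ∅ then ∅ else {∅}⟩

/-- The Morse tile `σ * θ̊ * τ̇`. -/
def splitTile (σ θ τ : Finset V) : RelCplx V :=
  (closedT σ).join ((openT θ).join (dotT τ))

/-- A tiling of a relative simplicial complex by `N` relative facets: the tiles
are relative simplices whose underlying simplices are facets, and their faces
partition the faces of `S`. -/
structure Tiling (S : RelCplx W) (N : ℕ) where
  tile : Fin N → RelCplx W
  isFacet : ∀ i, ∃ σ ∈ S.K, (∀ τ ∈ S.K, σ ⊆ τ → τ = σ) ∧ (tile i).K = σ.powerset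
  subL : ∀ i, (tile i).L ⊆ (tile i).K
  disj : ∀ i j, i ≠ j → Disjoint (tile i).faces (tile j).faces
  cover : (Finset.univ : Finset (Fin N)).biUnion (fun i => (tile i).faces) = S.faces

/-- The union of the faces of the first `p` tiles of a tiling. -/
def Tiling.prefixFaces {S : RelCplx W} {N : ℕ} (T : Tiling S N) (p : ℕ) :
    Finset (Finset W) :=
  (Finset.univ.filter fun i : Fin N => (i : ℕ) < p).biUnion fun i => (T.tile i).faces

/-- A tiling is a shelling when each of the sets of faces of `S_p = K_p \ L`
is a relative subcomplex, i.e. `L ∪ (tiles of index < p)` is a complex. -/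
def Tiling.IsShelling {S : RelCplx W} {N : ℕ} (T : Tiling S N) : Prop :=
  ∀ p ≤ N, IsComplex (S.L ∪ T.prefixFaces p)

/-- A (shelled) tiling begins with a set `F` of faces when some initial segment
of its tiles partitions exactly `F`. -/
def Tiling.BeginsWith {S : RelCplx W} {N : ℕ} (T : Tiling S N)
    (F : Finset (Finset W)) : Prop :=
  ∃ p ≤ N, T.prefixFaces p = F

/-- A Morse tiling: all tiles are Morse tiles. -/
def Tiling.IsMorse {S : RelCplx W} {N : ℕ} (T : Tiling S N) : Prop :=
  ∀ i, ∃ n k, IsMorseTile (T.tile i) n k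

/-- An h-tiling: all tiles are basic or critical tiles. -/
def Tiling.IsH {S : RelCplx W} {N : ℕ} (T : Tiling S N) : Prop :=
  ∀ i, (∃ n k, IsBasicTile (T.tile i) n k) ∨ (∃ n k, IsCriticalTile (T.tile i) n k)

/-- `f` induces a simplicial isomorphism from `A` onto `B` (both viewed through
their collections of faces). -/
def IsSimplicialIso (f : V → W) (A : Finset (Finset V)) (B : Finset (Finset W)) : Prop :=
  Set.BijOn (fun σ : Finset V => σ.image f) ↑A ↑B

/-- `f` induces an isomorphism of relative simplicial complexes. -/
def IsRelIso (f : V → W) (S : RelCplx V) (S' : RelCplx W) : Prop :=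
  Set.BijOn (fun σ : Finset V => σ.image f) ↑S.K ↑S'.K ∧
    Set.BijOn (fun σ : Finset V => σ.image f) ↑S.L ↑S'.L

/-- The first derived neighborhood `N(L, K)` of a subcomplex `L` in `K` : the union
of the stars in `sd K` of the vertices of `L`. -/
def derivedNbhd (L K : Finset (Finset V)) : Finset (Finset (Finset V)) :=
  (L.filter fun s => s.card = 1).biUnion fun s => star (sd K) {s}

/-- The faces of the derived neighborhood `N(T, S)` of a tile `T` in a relative
complex `S`: the union of the relative stars in `sd S` of the vertices of `T`. -/
def relDerivedNbhd (T S : RelCplx V) : Finset (Finset (Finset V)) :=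
  ((suppK T).biUnion fun v => ((S.sdR).starR {({v} : Finset V)}).faces) ∩ (S.sdR).faces

/-- A discrete Morse function on the finite simplicial complex `K`. -/
def IsDiscreteMorse (K : Finset (Finset V)) (f : Finset V → ℝ) : Prop :=
  ∀ σ ∈ K, σ ≠ ∅ →
    (K.filter fun τ => σ ⊂ τ ∧ f τ ≤ f σ).card ≤ 1 ∧
    (K.filter fun θ => θ ≠ ∅ ∧ θ ⊂ σ ∧ f σ ≤ f θ).card ≤ 1

/-- A critical face of a discrete Morse function. -/
def IsCriticalFace (K : Finset (Finset V)) (f : Finset V → ℝ) (σ : Finset V) : Prop :=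
  σ ∈ K ∧ σ ≠ ∅ ∧ (∀ τ ∈ K, σ ⊂ τ → f σ < f τ) ∧
    ∀ θ ∈ K, θ ≠ ∅ → θ ⊂ σ → f θ < f σ

/-- An elementary collapse: removal of a facet `τ` together with a ridge `θ` of it
contained in no other facet. -/
def ElementaryCollapse (K K' : Finset (Finset V)) : Prop :=
  ∃ τ ∈ K, ∃ θ ∈ K, θ ⊆ τ ∧ τ.card = θ.card + 1 ∧
    (∀ ρ ∈ K, τ ⊆ ρ → ρ = τ) ∧
    (∀ ρ ∈ K, θ ⊆ ρ → ρ = θ ∨ ρ = τ) ∧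
    K' = (K.erase τ).erase θ

/-- A finite simplicial complex is collapsible when some finite sequence of
elementary collapses reduces it to a single vertex. -/
def Collapsible (K : Finset (Finset V)) : Prop :=
  ∃ v : V, Relation.ReflTransGen ElementaryCollapse K {∅, {v}}

set_option linter.unusedSectionVars false

/-! ### Chains of subsets and shellings by intervals -/

/-- `c` is a flag of nonempty subsets of `X`, i.e. a simplex of `sd X.powerset`. -/
def IsFlag (X : Finset V) (c : Finset (Finset V)) : Prop :=
  ∀ a ∈ c, a ≠ ∅ ∧ a ⊆ X ∧ ∀ b ∈ c, a ⊆ b ∨ b ⊆ a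

/-- `c` is not a simplex of the subdivision of the faces which do not contain `B`. -/
def Reaches (B : Finset V) (c : Finset (Finset V)) : Prop := B = ∅ ∨ ∃ a ∈ c, B ⊆ a

theorem IsFlag.mono {X : Finset V} {c d : Finset (Finset V)} (h : IsFlag X c) (hd : d ⊆ c) :
    IsFlag X d := fun a ha =>
  ⟨(h a (hd ha)).1, (h a (hd ha)).2.1, fun b hb => (h a (hd ha)).2.2 b (hd hb)⟩

theorem Reaches.mono {B : Finset V} {c d : Finset (Finset V)} (h : Reaches B c) (hd : c ⊆ d) :
    Reaches B d := h.imp_right fun ⟨a, ha, hB⟩ => ⟨a, hd ha, hB⟩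

theorem IsFlag.card_le {X : Finset V} {c : Finset (Finset V)} (h : IsFlag X c) :
    c.card ≤ X.card := by
  have : c.card ≤ (Finset.Icc 1 X.card).card := by
    refine Finset.card_le_card_of_injOn Finset.card ?_ ?_
    · intro a ha
      have := h a ha
      simp only [Finset.coe_Icc, Set.mem_Icc]
      exact ⟨Finset.card_pos.2 (Finset.nonempty_iff_ne_empty.2 this.1),
        Finset.card_le_card this.2.1⟩
    · intro a ha b hb hab
      rcases (h a ha).2.2 b hb with h1 | h1
      · exact Finset.eq_of_subset_of_card_le h1 hab.ge
      · exact (Finset.eq_of_subset_of_card_le h1 hab.le).symm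
  simpa using this

/-- The simplices of `sd (X \ {faces not containing B})`. -/
def relFlags (X B : Finset V) : Set (Finset (Finset V)) := {c | IsFlag X c ∧ Reaches B c}

/-- The simplices of the derived neighborhood of `U` among those of `relFlags X B`. -/
def nbhdFlags (X B U : Finset V) : Set (Finset (Finset V)) :=
  {c | IsFlag X c ∧ Reaches B c ∧ ∃ v ∈ U, ∀ a ∈ c, v ∈ a}

theorem nbhdFlags_empty (X B : Finset V) : nbhdFlags X B ∅ = ∅ := by
  ext c; simp [nbhdFlags]

theorem nbhdFlags_self {X : Finset V} (B : Finset V) (hX : X.Nonempty) :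
    nbhdFlags X B X = relFlags X B := by
  ext c
  refine ⟨fun h => ⟨h.1, h.2.1⟩, fun h => ⟨h.1, h.2, ?_⟩⟩
  rcases c.eq_empty_or_nonempty with rfl | hc
  · exact ⟨hX.choose, hX.choose_spec, by simp⟩
  · obtain ⟨a, ha, hmin⟩ := c.exists_min_image Finset.card hc
    obtain ⟨v, hv⟩ := Finset.nonempty_iff_ne_empty.2 (h.1 a ha).1
    refine ⟨v, (h.1 a ha).2.1 hv, fun b hb => ?_⟩
    rcases (h.1 a ha).2.2 b hb with h1 | h1
    · exact h1 hv
    · rwa [Finset.eq_of_subset_of_card_le h1 (hmin b hb)]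

/-- The set of faces of the basic tile with underlying simplex `t.1` and
restriction set `t.2`. -/
def tileFaces (t : Finset (Finset V) × Finset (Finset V)) : Set (Finset (Finset V)) :=
  {c | t.2 ⊆ c ∧ c ⊆ t.1}

/-- The basic tile `t` may be added to the set `D` in a shelling of `relFlags X B`. -/
structure CanAdd (X B : Finset V) (D : Set (Finset (Finset V)))
    (t : Finset (Finset V) × Finset (Finset V)) : Prop where
  sub : t.2 ⊆ t.1
  flag : IsFlag X t.1
  card : t.1.card = X.card
  reaches : Reaches B t.2
  iff : ∀ d ⊆ t.1, Reaches B d → (t.2 ⊆ d ↔ d ∉ D)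

/-- Successively adding the tiles of the list leads from `D` to `D'`. -/
def Shells (X B : Finset V) : Set (Finset (Finset V)) →
    List (Finset (Finset V) × Finset (Finset V)) → Set (Finset (Finset V)) → Prop
  | D, [], D' => D = D'
  | D, t :: l, D' => CanAdd X B D t ∧ Shells X B (D ∪ tileFaces t) l D'

section Shells

variable {X B : Finset V} {D D' D'' : Set (Finset (Finset V))}
  {t : Finset (Finset V) × Finset (Finset V)}
  {l l' : List (Finset (Finset V) × Finset (Finset V))}

theorem Shells.append (h : Shells X B D l D') (h' : Shells X B D' l' D'') :
    Shells X B D (l ++ l') D'' := by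
  induction l generalizing D with
  | nil => cases h; exact h'
  | cons t l ih => exact ⟨h.1, ih h.2⟩

theorem Shells.split (h : Shells X B D (l ++ l') D'') :
    ∃ D', Shells X B D l D' ∧ Shells X B D' l' D'' := by
  induction l generalizing D with
  | nil => exact ⟨D, rfl, h⟩
  | cons t l ih =>
    obtain ⟨D', h1, h2⟩ := ih h.2
    exact ⟨D', ⟨h.1, h1⟩, h2⟩

theorem Shells.eq_union (h : Shells X B D l D') : D' = D ∪ {c | ∃ t ∈ l, c ∈ tileFaces t} := by
  induction l generalizing D with
  | nil => cases h; simp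
  | cons t l ih =>
    rw [ih h.2]
    ext c
    simp [or_assoc]

theorem CanAdd.notMem (h : CanAdd X B D t) {c : Finset (Finset V)} (hc : c ∈ tileFaces t) :
    c ∉ D := (h.iff c hc.2 (h.reaches.mono hc.1)).1 hc.1

theorem Shells.notMem (h : Shells X B D l D') (ht : t ∈ l) {c : Finset (Finset V)}
    (hc : c ∈ tileFaces t) : c ∉ D := by
  induction l generalizing D with
  | nil => simp at ht
  | cons s l ih =>
    rcases List.mem_cons.1 ht with rfl | ht
    · exact h.1.notMem hc
    · exact fun hD => ih h.2 ht (Or.inl hD)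

theorem Shells.mem (h : Shells X B D l D') (ht : t ∈ l) {c : Finset (Finset V)}
    (hc : c ∈ tileFaces t) : c ∈ D' := by
  rw [h.eq_union]; exact Or.inr ⟨t, ht, hc⟩

theorem Shells.basic (h : Shells X B D l D') (ht : t ∈ l) :
    t.2 ⊆ t.1 ∧ IsFlag X t.1 ∧ t.1.card = X.card ∧ Reaches B t.2 := by
  induction l generalizing D with
  | nil => simp at ht
  | cons s l ih =>
    rcases List.mem_cons.1 ht with rfl | ht
    · exact ⟨h.1.sub, h.1.flag, h.1.card, h.1.reaches⟩
    · exact ih h.2 ht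

theorem Shells.top_mem (h : Shells X B D l D') (ht : t ∈ l) : t.1 ∈ tileFaces t :=
  ⟨(h.basic ht).1, subset_rfl⟩

theorem Shells.top_mem_relFlags (h : Shells X B D l D') (ht : t ∈ l) : t.1 ∈ relFlags X B :=
  ⟨(h.basic ht).2.1, (h.basic ht).2.2.2.mono (h.basic ht).1⟩

theorem Shells.pairwise (h : Shells X B D l D') :
    l.Pairwise fun s t => Disjoint (tileFaces s) (tileFaces t) := by
  induction l generalizing D with
  | nil => exact List.Pairwise.nil
  | cons s l ih =>
    refine List.Pairwise.cons (fun t ht => ?_) (ih h.2)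
    exact Set.disjoint_left.2 fun c hs hc => h.2.notMem ht hc (Or.inr hs)

theorem Shells.closed (h : Shells X B D l D')
    (hD : ∀ c ∈ D, ∀ d ⊆ c, Reaches B d → d ∈ D) :
    ∀ c ∈ D', ∀ d ⊆ c, Reaches B d → d ∈ D' := by
  induction l generalizing D with
  | nil => cases h; exact hD
  | cons s l ih =>
    refine ih h.2 ?_
    rintro c (hc | hc) d hd hB
    · exact Or.inl (hD c hc d hd hB)
    · by_cases hdD : d ∈ D
      · exact Or.inl hdD
      · exact Or.inr ⟨(h.1.iff d (hd.trans hc.2) hB).2 hdD, hd.trans hc.2⟩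

end Shells

/-! ### Coning a flag off a new first vertex -/

/-- The flag obtained by adding `v` to every member. -/
def lift (v : V) (c : Finset (Finset V)) : Finset (Finset V) := c.image (insert v)

section Lift

variable {X B E : Finset V} {v : V} {c d : Finset (Finset V)}

theorem mem_of_mem_lift {a : Finset V} (ha : a ∈ lift v c) : v ∈ a := by
  obtain ⟨b, -, rfl⟩ := Finset.mem_image.1 ha
  exact Finset.mem_insert_self _ _

theorem IsFlag.notMem (hc : IsFlag (X.erase v) c) {a : Finset V} (ha : a ∈ c) : v ∉ a :=
  fun h => Finset.notMem_erase v X ((hc a ha).2.1 h)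

theorem singleton_notMem_lift (hc : IsFlag (X.erase v) c) : {v} ∉ lift v c := by
  intro h
  obtain ⟨b, hb, hbv⟩ := Finset.mem_image.1 h
  refine (hc b hb).1 (Finset.eq_empty_of_forall_notMem fun x hx => ?_)
  have : x ∈ ({v} : Finset V) := hbv ▸ Finset.mem_insert_of_mem hx
  rw [Finset.mem_singleton] at this
  exact hc.notMem hb (this ▸ hx)

theorem lift_subset_lift (hc : IsFlag (X.erase v) c) (hd : IsFlag (X.erase v) d) :
    lift v c ⊆ lift v d ↔ c ⊆ d := by
  refine ⟨fun h a ha => ?_, Finset.image_subset_image⟩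
  obtain ⟨b, hb, hab⟩ := Finset.mem_image.1 (h (Finset.mem_image_of_mem _ ha))
  have := congrArg (fun s => s.erase v) hab
  simp only [Finset.erase_insert (hd.notMem hb), Finset.erase_insert (hc.notMem ha)] at this
  exact this ▸ hb

theorem lift_inj (hc : IsFlag (X.erase v) c) (hd : IsFlag (X.erase v) d) :
    lift v c = lift v d ↔ c = d := by
  rw [Finset.Subset.antisymm_iff, Finset.Subset.antisymm_iff, lift_subset_lift hc hd,
    lift_subset_lift hd hc]

theorem insert_lift_subset (hc : IsFlag (X.erase v) c) (hd : IsFlag (X.erase v) d) :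
    insert {v} (lift v c) ⊆ insert {v} (lift v d) ↔ c ⊆ d := by
  rw [Finset.insert_subset_insert_iff (singleton_notMem_lift hc), lift_subset_lift hc hd]

theorem lift_subset_insert_lift (hc : IsFlag (X.erase v) c) (hd : IsFlag (X.erase v) d) :
    lift v c ⊆ insert {v} (lift v d) ↔ c ⊆ d := by
  rw [Finset.subset_insert_iff_of_notMem (singleton_notMem_lift hc), lift_subset_lift hc hd]

theorem insert_lift_inj (hc : IsFlag (X.erase v) c) (hd : IsFlag (X.erase v) d) :
    insert {v} (lift v c) = insert {v} (lift v d) ↔ c = d := by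
  rw [Finset.Subset.antisymm_iff, Finset.Subset.antisymm_iff, insert_lift_subset hc hd,
    insert_lift_subset hd hc]

theorem lift_ne_insert_lift (hc : IsFlag (X.erase v) c) :
    lift v c ≠ insert {v} (lift v d) := fun h =>
  singleton_notMem_lift hc (h ▸ Finset.mem_insert_self _ _)

theorem card_insert_lift (hc : IsFlag (X.erase v) c) :
    (insert {v} (lift v c)).card = c.card + 1 := by
  rw [Finset.card_insert_of_notMem (singleton_notMem_lift hc), lift, Finset.card_image_of_injOn]
  intro a ha b hb hab
  have := congrArg (fun s => s.erase v) hab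
  simpa only [Finset.erase_insert (hc.notMem ha), Finset.erase_insert (hc.notMem hb)] using this

theorem isFlag_insert_lift (hv : v ∈ X) (hc : IsFlag (X.erase v) c) :
    IsFlag X (insert {v} (lift v c)) := by
  intro a ha
  have key : ∀ a ∈ insert {v} (lift v c), ∃ b, a = insert v b ∧ (b = ∅ ∨ b ∈ c) := by
    intro a ha
    rcases Finset.mem_insert.1 ha with rfl | ha
    · exact ⟨∅, rfl, Or.inl rfl⟩
    · obtain ⟨b, hb, rfl⟩ := Finset.mem_image.1 ha
      exact ⟨b, rfl, Or.inr hb⟩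
  obtain ⟨a, rfl, ha'⟩ := key a ha
  refine ⟨Finset.insert_ne_empty _ _, ?_, ?_⟩
  · rcases ha' with rfl | ha'
    · simpa using hv
    · exact Finset.insert_subset hv ((hc a ha').2.1.trans (Finset.erase_subset _ _))
  · intro b hb
    obtain ⟨b, rfl, hb'⟩ := key b hb
    rcases ha' with rfl | ha'
    · exact Or.inl (Finset.insert_subset_insert _ (Finset.empty_subset _))
    rcases hb' with rfl | hb'
    · exact Or.inr (Finset.insert_subset_insert _ (Finset.empty_subset _))
    exact ((hc a ha').2.2 b hb').imp (Finset.insert_subset_insert _)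
      (Finset.insert_subset_insert _)

theorem isFlag_lift (hv : v ∈ X) (hc : IsFlag (X.erase v) c) : IsFlag X (lift v c) :=
  (isFlag_insert_lift hv hc).mono (Finset.subset_insert _ _)

theorem reaches_insert_lift : Reaches B (insert {v} (lift v c)) ↔ Reaches (B.erase v) c := by
  simp only [Reaches, lift, Finset.exists_mem_insert, Finset.exists_mem_image,
    Finset.subset_insert_iff, Finset.subset_singleton_iff, Finset.erase_eq_empty_iff]
  tauto

theorem reaches_lift : Reaches B (lift v c) ↔ B = ∅ ∨ (c.Nonempty ∧ Reaches (B.erase v) c) := by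
  simp only [Reaches, lift, Finset.exists_mem_image, Finset.subset_insert_iff]
  refine or_congr_right ⟨fun ⟨a, ha, h⟩ => ⟨⟨a, ha⟩, Or.inr ⟨a, ha, h⟩⟩, ?_⟩
  rintro ⟨⟨a, ha⟩, h | h⟩
  · exact ⟨a, ha, by simp [h]⟩
  · exact h

theorem Reaches.of_lift (h : Reaches B (lift v c)) : Reaches (B.erase v) c := by
  rcases reaches_lift.1 h with rfl | h
  · exact Or.inl (by simp)
  · exact h.2

theorem subset_insert_lift (hd : d ⊆ insert {v} (lift v c)) :
    ∃ d' ⊆ c, d = lift v d' ∨ d = insert {v} (lift v d') := by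
  obtain ⟨d', hd', he⟩ := Finset.subset_image_iff.1
    (show d.erase {v} ⊆ c.image (insert v) from (Finset.subset_insert_iff.1 hd))
  refine ⟨d', hd', ?_⟩
  by_cases h : {v} ∈ d
  · exact Or.inr (by rw [lift, he, Finset.insert_erase h])
  · exact Or.inl (by rw [lift, he, Finset.erase_eq_of_notMem h])

/-- Every flag all of whose members contain `v` comes from a flag of `X.erase v`. -/
theorem IsFlag.exists_lift (hc : IsFlag X c) (hv : ∀ a ∈ c, v ∈ a) :
    ∃ c', IsFlag (X.erase v) c' ∧ (c = lift v c' ∨ c = insert {v} (lift v c')) := by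
  refine ⟨(c.erase {v}).image fun a => a.erase v, ?_, ?_⟩
  · intro a ha
    obtain ⟨a, ha', rfl⟩ := Finset.mem_image.1 ha
    obtain ⟨hav, ha⟩ := Finset.mem_erase.1 ha'
    refine ⟨?_, Finset.erase_subset_erase _ (hc a ha).2.1, ?_⟩
    · intro h
      rcases (Finset.erase_eq_empty_iff _ _).1 h with h | h
      · exact (hc a ha).1 h
      · exact hav h
    · intro b hb
      obtain ⟨b, hb', rfl⟩ := Finset.mem_image.1 hb
      exact ((hc a ha).2.2 b (Finset.mem_of_mem_erase hb')).imp (Finset.erase_subset_erase _)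
        (Finset.erase_subset_erase _)
  · have : lift v ((c.erase {v}).image fun a => a.erase v) = c.erase {v} := by
      rw [lift, Finset.image_image]
      conv_rhs => rw [← Finset.image_id (s := c.erase {v})]
      refine Finset.image_congr fun a ha => ?_
      exact Finset.insert_erase (hv a (Finset.mem_of_mem_erase ha))
    rw [this]
    by_cases h : {v} ∈ c
    · exact Or.inr (Finset.insert_erase h).symm
    · exact Or.inl (Finset.erase_eq_of_notMem h).symm

theorem lift_mem_nbhdFlags (hv : v ∈ X) (hE : v ∉ E) (hc : IsFlag (X.erase v) c)
    (hB : Reaches B (lift v c)) :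
    lift v c ∈ nbhdFlags X B E ↔ c ∈ nbhdFlags (X.erase v) (B.erase v) E := by
  refine ⟨fun ⟨_, _, w, hw, h⟩ => ⟨hc, hB.of_lift, w, hw, fun a ha => ?_⟩,
    fun ⟨_, _, w, hw, h⟩ => ⟨isFlag_lift hv hc, hB, w, hw, fun a ha => ?_⟩⟩
  · have := h _ (Finset.mem_image_of_mem _ ha)
    exact Finset.mem_of_mem_insert_of_ne this (fun h => hE (h ▸ hw))
  · obtain ⟨b, hb, rfl⟩ := Finset.mem_image.1 ha
    exact Finset.mem_insert_of_mem (h b hb)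

theorem insert_lift_notMem_nbhdFlags (hE : v ∉ E) :
    insert {v} (lift v c) ∉ nbhdFlags X B E := by
  rintro ⟨_, _, w, hw, h⟩
  have := h {v} (Finset.mem_insert_self _ _)
  exact hE (Finset.mem_singleton.1 this ▸ hw)

end Lift

/-- The tiles of `nbhdFlags (X.erase v) (B.erase v) E` give tiles containing `{v}` in
their restriction set. -/
def coneTile (v : V) (t : Finset (Finset V) × Finset (Finset V)) :
    Finset (Finset V) × Finset (Finset V) :=
  (insert {v} (lift v t.1), insert {v} (lift v t.2))

/-- The other tiles are simply coned off. -/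
def freeTile (v : V) (t : Finset (Finset V) × Finset (Finset V)) :
    Finset (Finset V) × Finset (Finset V) :=
  (insert {v} (lift v t.1), lift v t.2)

section Step

variable {X B E : Finset V} {v : V} {D D' : Set (Finset (Finset V))}
  {l : List (Finset (Finset V) × Finset (Finset V))}

theorem Shells.cone (hv : v ∈ X) (hE : v ∉ E) (h : Shells (X.erase v) (B.erase v) D l D')
    (hD : ∀ c ∈ D, IsFlag (X.erase v) c)
    (hl : ∀ t ∈ l, t.1 ∈ nbhdFlags (X.erase v) (B.erase v) E) :
    Shells X B (nbhdFlags X B E ∪ {c | ∃ c' ∈ D, c = insert {v} (lift v c')})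
      (l.map (coneTile v))
      (nbhdFlags X B E ∪ {c | ∃ c' ∈ D', c = insert {v} (lift v c')}) := by
  induction l generalizing D with
  | nil => cases h; rfl
  | cons t l ih =>
    obtain ⟨ht, hs⟩ := h
    have hf := ht.flag
    refine ⟨⟨?_, isFlag_insert_lift hv hf, ?_, reaches_insert_lift.2 ht.reaches, ?_⟩, ?_⟩
    · exact (insert_lift_subset (hf.mono ht.sub) hf).2 ht.sub
    · rw [coneTile, card_insert_lift hf, ht.card, Finset.card_erase_add_one hv]
    · intro d hd hB
      obtain ⟨d', hd', rfl | rfl⟩ := subset_insert_lift hd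
      · have hfd := hf.mono hd'
        have : lift v d' ∈ nbhdFlags X B E := by
          rw [lift_mem_nbhdFlags hv hE hfd hB]
          obtain ⟨_, _, w, hw, h⟩ := hl t (by simp)
          exact ⟨hfd, hB.of_lift, w, hw, fun a ha => h a (hd' ha)⟩
        refine iff_of_false (fun h => ?_) (fun h => h (Or.inl this))
        exact singleton_notMem_lift hfd (h (Finset.mem_insert_self _ _))
      · have hfd := hf.mono hd'
        rw [coneTile, insert_lift_subset (hf.mono ht.sub) hfd,
          ht.iff d' hd' (reaches_insert_lift.1 hB), not_iff_not]
        refine ⟨fun h => Or.inr ⟨d', h, rfl⟩, ?_⟩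
        rintro (h | ⟨c', hc', h⟩)
        · exact absurd h (insert_lift_notMem_nbhdFlags hE)
        · rwa [(insert_lift_inj hfd (hD c' hc')).1 h]
    · have := ih hs ?_ (fun t ht => hl t (List.mem_cons_of_mem _ ht))
      · convert this using 1
        rw [Set.union_assoc]
        congr 1
        ext c
        constructor
        · rintro (⟨c', hc', rfl⟩ | ⟨h1, h2⟩)
          · exact ⟨c', Or.inl hc', rfl⟩
          · obtain ⟨d', hd', rfl | rfl⟩ := subset_insert_lift h2
            · exact absurd (h1 (Finset.mem_insert_self _ _))
                (singleton_notMem_lift (hf.mono hd'))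
            · exact ⟨d', Or.inr ⟨(insert_lift_subset (hf.mono ht.sub) (hf.mono hd')).1 h1, hd'⟩,
                rfl⟩
        · rintro ⟨c', hc' | hc', rfl⟩
          · exact Or.inl ⟨c', hc', rfl⟩
          · exact Or.inr ⟨(insert_lift_subset (hf.mono ht.sub) (hf.mono hc'.2)).2 hc'.1,
              (insert_lift_subset (hf.mono hc'.2) hf).2 hc'.2⟩
      · rintro c (hc | hc)
        · exact hD c hc
        · exact hf.mono hc.2

theorem Shells.free (hv : v ∈ X) (hE : v ∉ E) (hBE : B = {v} → E.Nonempty)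
    (h : Shells (X.erase v) (B.erase v) D l D')
    (hD : ∀ c ∈ D, IsFlag (X.erase v) c)
    (hN : nbhdFlags (X.erase v) (B.erase v) E ⊆ D) :
    Shells X B
      (nbhdFlags X B E ∪
        {c | Reaches B c ∧ ∃ c' ∈ D, c = lift v c' ∨ c = insert {v} (lift v c')})
      (l.map (freeTile v))
      (nbhdFlags X B E ∪
        {c | Reaches B c ∧ ∃ c' ∈ D', c = lift v c' ∨ c = insert {v} (lift v c')}) := by
  induction l generalizing D with
  | nil => cases h; rfl
  | cons t l ih =>
    obtain ⟨ht, hs⟩ := h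
    have hf := ht.flag
    have hr : Reaches B (lift v t.2) := by
      rw [reaches_lift]
      by_cases h0 : t.2 = ∅
      · left
        by_contra hB
        have hB' : B.erase v = ∅ := by
          have := ht.reaches
          rw [h0] at this
          simpa [Reaches] using this
        have hBv : B = {v} := ((Finset.erase_eq_empty_iff _ _).1 hB').resolve_left hB
        obtain ⟨w, hw⟩ := hBE hBv
        refine ht.notMem (c := ∅) ⟨by simp [h0], by simp⟩ (hN ⟨?_, Or.inl hB', w, hw, ?_⟩)
        · intro a ha; simp at ha
        · intro a ha; simp at ha
      · exact Or.inr ⟨Finset.nonempty_iff_ne_empty.2 h0, ht.reaches⟩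
    refine ⟨⟨?_, isFlag_insert_lift hv hf, ?_, hr, ?_⟩, ?_⟩
    · exact (lift_subset_insert_lift (hf.mono ht.sub) hf).2 ht.sub
    · rw [freeTile, card_insert_lift hf, ht.card, Finset.card_erase_add_one hv]
    · intro d hd hB
      obtain ⟨d', hd', rfl | rfl⟩ := subset_insert_lift hd
      · have hfd := hf.mono hd'
        rw [freeTile, lift_subset_lift (hf.mono ht.sub) hfd, ht.iff d' hd' hB.of_lift,
          not_iff_not]
        refine ⟨fun h => Or.inr ⟨hB, d', h, Or.inl rfl⟩, ?_⟩
        rintro (h | ⟨-, c', hc', h | h⟩)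
        · exact hN ((lift_mem_nbhdFlags hv hE hfd hB).1 h)
        · rwa [(lift_inj hfd (hD c' hc')).1 h]
        · exact absurd h (lift_ne_insert_lift hfd)
      · have hfd := hf.mono hd'
        rw [freeTile, lift_subset_insert_lift (hf.mono ht.sub) hfd,
          ht.iff d' hd' (reaches_insert_lift.1 hB), not_iff_not]
        refine ⟨fun h => Or.inr ⟨hB, d', h, Or.inr rfl⟩, ?_⟩
        rintro (h | ⟨-, c', hc', h | h⟩)
        · exact absurd h (insert_lift_notMem_nbhdFlags hE)
        · exact absurd h.symm (lift_ne_insert_lift (hD c' hc'))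
        · rwa [(insert_lift_inj hfd (hD c' hc')).1 h]
    · have := ih hs ?_ (hN.trans Set.subset_union_left)
      · convert this using 1
        rw [Set.union_assoc]
        congr 1
        ext c
        constructor
        · rintro (⟨hB, c', hc', h⟩ | ⟨h1, h2⟩)
          · exact ⟨hB, c', Or.inl hc', h⟩
          · refine ⟨hr.mono h1, ?_⟩
            obtain ⟨d', hd', rfl | rfl⟩ := subset_insert_lift h2
            · exact ⟨d', Or.inr ⟨(lift_subset_lift (hf.mono ht.sub) (hf.mono hd')).1 h1, hd'⟩,
                Or.inl rfl⟩
            · exact ⟨d', Or.inr ⟨(lift_subset_insert_lift (hf.mono ht.sub)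
                (hf.mono hd')).1 h1, hd'⟩, Or.inr rfl⟩
        · rintro ⟨hB, c', hc' | hc', h⟩
          · exact Or.inl ⟨hB, c', hc', h⟩
          · right
            rcases h with rfl | rfl
            · exact ⟨(lift_subset_lift (hf.mono ht.sub) (hf.mono hc'.2)).2 hc'.1,
                (lift_subset_insert_lift (hf.mono hc'.2) hf).2 hc'.2⟩
            · exact ⟨(lift_subset_insert_lift (hf.mono ht.sub) (hf.mono hc'.2)).2 hc'.1,
                (insert_lift_subset (hf.mono hc'.2) hf).2 hc'.2⟩
      · rintro c (hc | hc)
        · exact hD c hc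
        · exact hf.mono hc.2

end Step

/-- `relFlags X B` admits a shelling by basic tiles beginning with the derived neighborhood
of `U`, having an open tile only if `B = X`, in which case it is unique and lies outside of
the neighborhood unless `U = X`. -/
def HasShelling (X B U : Finset V) : Prop :=
  ∃ l₁ l₂, Shells X B ∅ l₁ (nbhdFlags X B U) ∧
    Shells X B (nbhdFlags X B U) l₂ (relFlags X B) ∧
    (∀ t ∈ l₁ ++ l₂, t.2 = t.1 → B = X) ∧
    (∀ t ∈ l₁, t.2 = t.1 → U = X) ∧
    (∀ s ∈ l₁ ++ l₂, ∀ t ∈ l₁ ++ l₂, s.2 = s.1 → t.2 = t.1 → s = t) ∧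
    (B = X → ∃ t ∈ l₁ ++ l₂, t.2 = t.1)

section Existence

variable {X B E : Finset V} {v : V}

theorem nbhdFlags_insert (hv : v ∈ X) :
    nbhdFlags X B (insert v E) = nbhdFlags X B E ∪
      {c | Reaches B c ∧ ∃ c' ∈ relFlags (X.erase v) (B.erase v),
        c = lift v c' ∨ c = insert {v} (lift v c')} := by
  ext c
  constructor
  · rintro ⟨hc, hB, w, hw, h⟩
    rcases Finset.mem_insert.1 hw with rfl | hw
    · obtain ⟨c', hc', hcc⟩ := hc.exists_lift h
      refine Or.inr ⟨hB, c', ⟨hc', ?_⟩, hcc⟩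
      rcases hcc with rfl | rfl
      · exact hB.of_lift
      · exact reaches_insert_lift.1 hB
    · exact Or.inl ⟨hc, hB, w, hw, h⟩
  · rintro (⟨hc, hB, w, hw, h⟩ | ⟨hB, c', ⟨hc', hB'⟩, rfl | rfl⟩)
    · exact ⟨hc, hB, w, Finset.mem_insert_of_mem hw, h⟩
    · exact ⟨isFlag_lift hv hc', hB, v, Finset.mem_insert_self _ _, fun a => mem_of_mem_lift⟩
    · refine ⟨isFlag_insert_lift hv hc', hB, v, Finset.mem_insert_self _ _, fun a ha => ?_⟩
      rcases Finset.mem_insert.1 ha with rfl | ha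
      · exact Finset.mem_singleton_self v
      · exact mem_of_mem_lift ha

theorem HasShelling.insert_vertex (hX : 1 < X.card) (hv : v ∈ X) (hE : v ∉ E)
    (h0 : B = E → B = ∅ ∨ B = X) (h1 : B = insert v E → B = X)
    (h : HasShelling (X.erase v) (B.erase v) E) :
    ∃ l, Shells X B (nbhdFlags X B E) l (nbhdFlags X B (insert v E)) ∧
      (∀ t ∈ l, t.2 = t.1 → E = X.erase v ∧ B = X) ∧
      (∀ s ∈ l, ∀ t ∈ l, s.2 = s.1 → t.2 = t.1 → s = t) ∧
      (E = X.erase v → B = X → ∃ t ∈ l, t.2 = t.1) := by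
  obtain ⟨l₁, l₂, hs₁, hs₂, hf, hf₁, hu, hex⟩ := h
  have hXv : (X.erase v).Nonempty := by
    rw [← Finset.card_pos, Finset.card_erase_of_mem hv]; omega
  have hfull : ∀ t ∈ l₁.map (coneTile v) ++ l₂.map (freeTile v), t.2 = t.1 →
      ∃ s ∈ l₁, s.2 = s.1 ∧ t = coneTile v s := by
    intro t ht h
    rcases List.mem_append.1 ht with ht | ht
    · obtain ⟨s, hs, rfl⟩ := List.mem_map.1 ht
      have hb := hs₁.basic hs
      exact ⟨s, hs, (insert_lift_inj (hb.2.1.mono hb.1) hb.2.1).1 h, rfl⟩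
    · obtain ⟨s, hs, rfl⟩ := List.mem_map.1 ht
      have hb := hs₂.basic hs
      exact absurd h (lift_ne_insert_lift (hb.2.1.mono hb.1))
  refine ⟨l₁.map (coneTile v) ++ l₂.map (freeTile v), ?_, ?_, ?_, ?_⟩
  · have a₁ := hs₁.cone (B := B) hv hE (by simp) (fun t ht => hs₁.mem ht (hs₁.top_mem ht))
    have a₂ := hs₂.free (B := B) hv hE ?_ (fun c hc => hc.1) subset_rfl
    · rw [nbhdFlags_insert hv]
      refine Shells.append (D' := nbhdFlags X B E ∪ {c | Reaches B c ∧
        ∃ c' ∈ nbhdFlags (X.erase v) (B.erase v) E,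
          c = lift v c' ∨ c = insert {v} (lift v c')}) ?_ a₂
      convert a₁ using 1
      · simp
      · ext c
        constructor
        · rintro (h | ⟨hB, c', hc', rfl | rfl⟩)
          · exact Or.inl h
          · exact Or.inl ((lift_mem_nbhdFlags hv hE hc'.1 hB).2 hc')
          · exact Or.inr ⟨c', hc', rfl⟩
        · rintro (h | ⟨c', hc', rfl⟩)
          · exact Or.inl h
          · exact Or.inr ⟨reaches_insert_lift.2 hc'.2.1, c', hc', Or.inr rfl⟩
    · intro hBv
      rw [Finset.nonempty_iff_ne_empty]
      rintro rfl
      have := h1 (by simpa using hBv)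
      rw [← this, hBv] at hX
      simp at hX
  · intro t ht h
    obtain ⟨s, hs, hs', rfl⟩ := hfull t ht h
    have hEX := hf₁ s hs hs'
    have hBX := hf s (List.mem_append_left _ hs) hs'
    refine ⟨hEX, ?_⟩
    by_cases hvB : v ∈ B
    · rw [← Finset.insert_erase hvB, hBX, Finset.insert_erase hv]
    · rw [Finset.erase_eq_of_notMem hvB] at hBX
      refine (h0 (hBX.trans hEX.symm)).resolve_left fun hB => ?_
      rw [← hBX, hB] at hXv
      simp at hXv
  · intro s hs t ht hs' ht'
    obtain ⟨s, hs₁, hs₂, rfl⟩ := hfull s hs hs'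
    obtain ⟨t, ht₁, ht₂, rfl⟩ := hfull t ht ht'
    rw [hu s (List.mem_append_left _ hs₁) t (List.mem_append_left _ ht₁) hs₂ ht₂]
  · intro hEX hBX
    obtain ⟨t, ht, ht'⟩ := hex (by rw [hBX])
    rcases List.mem_append.1 ht with ht | ht
    · exact ⟨coneTile v t, List.mem_append_left _ (List.mem_map_of_mem ht), by
        simp [coneTile, ht']⟩
    · refine absurd ?_ (hs₂.notMem ht (hs₂.top_mem ht))
      rw [hEX, nbhdFlags_self _ hXv]
      exact hs₂.top_mem_relFlags ht

/-- Shelling of the difference of two derived neighborhoods, one vertex at a time. -/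
theorem exists_shells_list (hX : 1 < X.card)
    (ih : ∀ v ∈ X, ∀ E ⊆ X.erase v, (E = B.erase v → E = ∅ ∨ E = X.erase v) →
      HasShelling (X.erase v) (B.erase v) E)
    (vs : List V) (E : Finset V) (hE : E ⊆ X) (hvs : ∀ v ∈ vs, v ∈ X ∧ v ∉ E) (hnd : vs.Nodup)
    (hB : ∀ a, a <+: vs → B = E ∪ a.toFinset → B = ∅ ∨ B = X) :
    ∃ l, Shells X B (nbhdFlags X B E) l (nbhdFlags X B (E ∪ vs.toFinset)) ∧
      (∀ t ∈ l, t.2 = t.1 → E ∪ vs.toFinset = X ∧ B = X) ∧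
      (∀ s ∈ l, ∀ t ∈ l, s.2 = s.1 → t.2 = t.1 → s = t) ∧
      (vs ≠ [] → E ∪ vs.toFinset = X → B = X → ∃ t ∈ l, t.2 = t.1) := by
  induction vs generalizing E with
  | nil => exact ⟨[], by simp [Shells], by simp, by simp, by simp⟩
  | cons v vs IH =>
    obtain ⟨hvX, hvE⟩ := hvs v (by simp)
    have hXne : X.Nonempty := ⟨v, hvX⟩
    have h0 : B = E → B = ∅ ∨ B = X := fun h => hB [] (by simp) (by simpa using h)
    have h1 : B = insert v E → B = X := fun h =>
      (hB [v] (by simp) (by rw [h]; ext; simp)).resolve_left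
        (by rw [h]; exact Finset.insert_ne_empty _ _)
    obtain ⟨l, hl, hlf, hlu, hle⟩ := (ih v hvX E (Finset.subset_erase.2 ⟨hE, hvE⟩) (by
      intro hEB
      by_cases hvB : v ∈ B
      · right
        have := h1 (by rw [hEB, Finset.insert_erase hvB])
        rw [hEB, this]
      · rw [Finset.erase_eq_of_notMem hvB] at hEB
        rcases h0 hEB.symm with h | h
        · exact Or.inl (hEB.trans h)
        · exact absurd (h ▸ hvX) hvB)).insert_vertex hX hvX hvE h0 h1
    have hcons : E ∪ (v :: vs).toFinset = insert v E ∪ vs.toFinset := by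
      ext; simp
    obtain ⟨m, hm, hmf, hmu, hme⟩ := IH (insert v E) (Finset.insert_subset hvX hE)
      (fun w hw => ⟨(hvs w (by simp [hw])).1, fun h => by
        rcases Finset.mem_insert.1 h with rfl | h
        · exact (List.nodup_cons.1 hnd).1 hw
        · exact (hvs w (by simp [hw])).2 h⟩) (List.nodup_cons.1 hnd).2
      (fun a ha h => hB (v :: a) (by simpa using ha) (by rw [h]; ext; simp))
    have hdone : E = X.erase v → ∀ t ∈ m, False := by
      intro h t ht
      refine hm.notMem ht (hm.top_mem ht) ?_
      rw [h, Finset.insert_erase hvX, nbhdFlags_self _ hXne]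
      exact hm.top_mem_relFlags ht
    rw [hcons]
    refine ⟨l ++ m, hl.append hm, ?_, ?_, ?_⟩
    · intro t ht h
      rcases List.mem_append.1 ht with ht | ht
      · obtain ⟨hEX, hBX⟩ := hlf t ht h
        refine ⟨?_, hBX⟩
        rw [hEX, Finset.insert_erase hvX, Finset.union_eq_left]
        intro w hw
        exact (hvs w (by simp [List.mem_toFinset.1 hw])).1
      · exact hmf t ht h
    · intro s hs t ht hs' ht'
      rcases List.mem_append.1 hs with hs | hs <;> rcases List.mem_append.1 ht with ht | ht
      · exact hlu s hs t ht hs' ht'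
      · exact (hdone (hlf s hs hs').1 t ht).elim
      · exact (hdone (hlf t ht ht').1 s hs).elim
      · exact hmu s hs t ht hs' ht'
    · intro _ hEX hBX
      by_cases hvs' : vs = []
      · subst hvs'
        obtain ⟨t, ht, h⟩ := hle (by simp at hEX; rw [← hEX, Finset.erase_insert hvE]) hBX
        exact ⟨t, List.mem_append_left _ ht, h⟩
      · obtain ⟨t, ht, h⟩ := hme hvs' hEX hBX
        exact ⟨t, List.mem_append_right _ ht, h⟩

theorem exists_list_toFinset (S : Finset V) (hS : ¬ S ⊆ B) :
    ∃ vs : List V, vs.Nodup ∧ vs.toFinset = S ∧ ∀ a, a <+: vs → a ≠ [] → ¬ a.toFinset ⊆ B := by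
  obtain ⟨w, hwS, hwB⟩ := Finset.not_subset.1 hS
  refine ⟨w :: (S.erase w).toList, ?_, ?_, ?_⟩
  · simp [Finset.nodup_toList]
  · rw [List.toFinset_cons, Finset.toList_toFinset, Finset.insert_erase hwS]
  · intro a ha hne h
    obtain ⟨x, a, rfl⟩ := List.exists_cons_of_ne_nil hne
    rw [List.cons_prefix_cons] at ha
    exact hwB (ha.1 ▸ h (by simp))

theorem exists_ordering {U : Finset V} (hB : B ⊆ X)
    (h : U = B → U = ∅ ∨ U = X) :
    ∃ us vs : List V, us.Nodup ∧ vs.Nodup ∧ us.toFinset = U ∧ vs.toFinset = X \ U ∧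
      (∀ a, a <+: us → B = a.toFinset → B = ∅ ∨ B = X) ∧
      (∀ a, a <+: vs → B = U ∪ a.toFinset → B = ∅ ∨ B = X) := by
  by_cases hUB : U ⊆ B
  · by_cases hXB : X \ U ⊆ B
    · have : B = X := by
        refine hB.antisymm fun x hx => ?_
        by_cases hxU : x ∈ U
        · exact hUB hxU
        · exact hXB (Finset.mem_sdiff.2 ⟨hx, hxU⟩)
      exact ⟨U.toList, (X \ U).toList, Finset.nodup_toList _, Finset.nodup_toList _, by simp,
        by simp, fun _ _ _ => Or.inr this, fun _ _ _ => Or.inr this⟩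
    · have h' : U = B → B = ∅ ∨ B = X := fun e => e ▸ h e
      obtain ⟨vs, hnd, hvs, ha⟩ := exists_list_toFinset _ hXB
      refine ⟨U.toList, vs, Finset.nodup_toList _, hnd, by simp, hvs, ?_, ?_⟩
      · intro a ha hBa
        refine h' (hUB.antisymm ?_)
        rw [hBa]
        intro x hx
        simpa using ha.subset (List.mem_toFinset.1 hx)
      · intro a hav hBa
        by_cases hane : a = []
        · exact h' (by simp [hBa, hane])
        · exact absurd (hBa ▸ Finset.subset_union_right) (ha a hav hane)
  · obtain ⟨us, hnd, hus, ha⟩ := exists_list_toFinset _ hUB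
    refine ⟨us, (X \ U).toList, hnd, Finset.nodup_toList _, hus, by simp, ?_, ?_⟩
    · intro a hau hBa
      by_cases hane : a = []
      · left; simp [hBa, hane]
      · exact absurd hBa.ge (ha a hau hane)
    · intro a _ hBa
      exact absurd (hBa ▸ Finset.subset_union_left) hUB

theorem isFlag_singleton_iff {c : Finset (Finset V)} : IsFlag {v} c ↔ c ⊆ {{v}} := by
  constructor
  · intro h a ha
    have := h a ha
    rw [Finset.mem_singleton]
    exact (Finset.subset_singleton_iff.1 this.2.1).resolve_left this.1
  · intro h a ha
    have := h ha
    rw [Finset.mem_singleton] at this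
    subst this
    refine ⟨by simp, subset_rfl, fun b hb => ?_⟩
    rw [Finset.mem_singleton.1 (h hb)]
    exact Or.inl subset_rfl

theorem hasShelling_singleton {U : Finset V} (hB : B ⊆ {v}) (hU : U ⊆ {v}) :
    HasShelling {v} B U := by
  have key : ∃ t, Shells {v} B ∅ [t] (relFlags {v} B) ∧ (t.2 = t.1 ↔ B = {v}) := by
    rcases Finset.subset_singleton_iff.1 hB with rfl | rfl
    · refine ⟨({{v}}, ∅), ⟨⟨by simp, isFlag_singleton_iff.2 subset_rfl, by simp, Or.inl rfl,
        by simp⟩, ?_⟩, ?_⟩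
      · ext c
        simp [relFlags, tileFaces, isFlag_singleton_iff, Reaches]
      · exact iff_of_false (Finset.singleton_ne_empty _).symm (Finset.singleton_ne_empty _).symm
    · have hr : ∀ d : Finset (Finset V), d ⊆ {{v}} → (Reaches {v} d ↔ {{v}} ⊆ d) := by
        intro d hd
        rcases Finset.subset_singleton_iff.1 hd with rfl | rfl <;> simp [Reaches]
      refine ⟨({{v}}, {{v}}), ⟨⟨by simp, isFlag_singleton_iff.2 subset_rfl, by simp,
        (hr _ subset_rfl).2 subset_rfl, fun d hd h => ?_⟩, ?_⟩, by simp⟩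
      · simpa using (hr d hd).1 h
      · ext c
        simp only [Set.empty_union, tileFaces, relFlags, Set.mem_ofPred_eq, isFlag_singleton_iff]
        constructor
        · rintro ⟨h1, h2⟩; exact ⟨h2, (hr c h2).2 h1⟩
        · rintro ⟨h1, h2⟩; exact ⟨(hr c h1).1 h2, h1⟩
  obtain ⟨t, ht, htB⟩ := key
  rcases Finset.subset_singleton_iff.1 hU with rfl | rfl
  · exact ⟨[], [t], by rw [nbhdFlags_empty]; rfl, by rwa [nbhdFlags_empty], by simp [htB],
      by simp, by simp, by simp [htB]⟩
  · have hN := nbhdFlags_self B (Finset.singleton_nonempty v)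
    exact ⟨[t], [], by rwa [hN], hN, by simp [htB], by simp, by simp, by simp [htB]⟩

theorem hasShelling {X B U : Finset V} (hX : X.Nonempty) (hB : B ⊆ X) (hU : U ⊆ X)
    (h : U = B → U = ∅ ∨ U = X) : HasShelling X B U := by
  induction hn : X.card generalizing X B U with
  | zero => exact absurd hn (Finset.card_ne_zero.2 hX)
  | succ n IH =>
    by_cases hX1 : X.card = 1
    · obtain ⟨v, rfl⟩ := Finset.card_eq_one.1 hX1
      exact hasShelling_singleton hB hU
    have hX2 : 1 < X.card := by omega
    have ih : ∀ v ∈ X, ∀ E ⊆ X.erase v, (E = B.erase v → E = ∅ ∨ E = X.erase v) →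
        HasShelling (X.erase v) (B.erase v) E := by
      intro v hv E hE h'
      have hc := Finset.card_erase_of_mem hv
      exact IH (Finset.card_pos.1 (by omega)) (Finset.erase_subset_erase _ hB) hE h' (by omega)
    obtain ⟨us, vs, hun, hvn, hus, hvs, hua, hva⟩ := exists_ordering hB h
    obtain ⟨l, hl, hlf, hlu, hle⟩ := exists_shells_list hX2 ih us ∅ (by simp)
      (fun v hv => ⟨hU (hus ▸ List.mem_toFinset.2 hv), by simp⟩) hun (by simpa using hua)
    obtain ⟨m, hm, hmf, hmu, hme⟩ := exists_shells_list hX2 ih vs U hU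
      (fun v hv => Finset.mem_sdiff.1 (hvs ▸ List.mem_toFinset.2 hv)) hvn hva
    rw [Finset.empty_union, hus] at hl hlf hle
    rw [hvs, Finset.union_sdiff_of_subset hU] at hm hmf hme
    rw [nbhdFlags_empty] at hl
    rw [nbhdFlags_self B hX] at hm
    have hdone : U = X → ∀ t ∈ m, False := by
      rintro rfl t ht
      refine hm.notMem ht (hm.top_mem ht) ?_
      rw [nbhdFlags_self _ hX]
      exact hm.top_mem_relFlags ht
    refine ⟨l, m, hl, hm, ?_, fun t ht h => (hlf t ht h).1, ?_, ?_⟩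
    · intro t ht h
      rcases List.mem_append.1 ht with ht | ht
      · exact (hlf t ht h).2
      · exact (hmf t ht h).2
    · intro s hs t ht hs' ht'
      rcases List.mem_append.1 hs with hs | hs <;> rcases List.mem_append.1 ht with ht | ht
      · exact hlu s hs t ht hs' ht'
      · exact (hdone (hlf s hs hs').1 t ht).elim
      · exact (hdone (hlf t ht ht').1 s hs).elim
      · exact hmu s hs t ht hs' ht'
    · intro hBX
      by_cases hUX : U = X
      · obtain ⟨t, ht, h'⟩ := hle (by rintro rfl; simp at hus; simp [← hUX, ← hus] at hX) hUX hBX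
        exact ⟨t, List.mem_append_left _ ht, h'⟩
      · obtain ⟨t, ht, h'⟩ := hme (by
          rintro rfl
          rw [List.toFinset_nil] at hvs
          exact hUX (hU.antisymm (Finset.sdiff_eq_empty_iff_subset.1 hvs.symm))) rfl hBX
        exact ⟨t, List.mem_append_right _ ht, h'⟩

end Existence

/-! ### Basic tiles as intervals -/

/-- The basic tile with underlying simplex `F` and restriction set `r`. -/
def intervalTile (F r : Finset V) : RelCplx V := ⟨F.powerset, F.powerset.filter fun c => ¬ r ⊆ c⟩

section IntervalTile

variable {F r : Finset V} {S : RelCplx V}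

theorem mem_faces_intervalTile {c : Finset V} : c ∈ (intervalTile F r).faces ↔ r ⊆ c ∧ c ⊆ F := by
  simp only [RelCplx.faces, intervalTile, Finset.mem_sdiff, Finset.mem_filter,
    Finset.mem_powerset]
  tauto

theorem mem_below_ridges {R : Finset (Finset V)} (hR : R ⊆ ridges F) {c : Finset V} :
    c ∈ below F R ↔ c ⊆ F ∧ ¬ restSet F R ⊆ c := by
  simp only [below, restSet, Finset.mem_filter, Finset.mem_powerset, Finset.not_subset]
  refine and_congr_right fun hc => ⟨?_, ?_⟩
  · rintro ⟨ρ, hρ, hcρ⟩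
    obtain ⟨v, hv, rfl⟩ := Finset.mem_image.1 (hR hρ)
    exact ⟨v, ⟨hv, hρ⟩, fun h => Finset.notMem_erase v F (hcρ h)⟩
  · rintro ⟨v, ⟨hv, hρ⟩, hvc⟩
    exact ⟨_, hρ, Finset.subset_erase.2 ⟨hc, hvc⟩⟩

theorem restSet_subset (R : Finset (Finset V)) : restSet F R ⊆ F := Finset.filter_subset _ _

theorem restSet_image (hr : r ⊆ F) : restSet F (r.image F.erase) = r := by
  ext v
  simp only [restSet, Finset.mem_filter, Finset.mem_image]
  constructor
  · rintro ⟨hv, w, hw, h⟩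
    by_contra hvr
    have : v ∈ F.erase w := Finset.mem_erase.2 ⟨fun e => hvr (e ▸ hw), hv⟩
    rw [h] at this
    exact Finset.notMem_erase v F this
  · exact fun hv => ⟨hr hv, v, hv, rfl⟩

theorem card_restSet {R : Finset (Finset V)} (hR : R ⊆ ridges F) :
    R.card = (restSet F R).card := by
  have : R = (restSet F R).image F.erase := by
    ext ρ
    simp only [restSet, Finset.mem_image, Finset.mem_filter]
    constructor
    · intro hρ
      obtain ⟨v, hv, rfl⟩ := Finset.mem_image.1 (hR hρ)
      exact ⟨v, ⟨hv, hρ⟩, rfl⟩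
    · rintro ⟨v, ⟨-, h⟩, rfl⟩
      exact h
  conv_lhs => rw [this]
  refine Finset.card_image_of_injOn fun v hv w hw h => ?_
  by_contra hne
  have hvF := restSet_subset R hv
  have : v ∈ F.erase w := Finset.mem_erase.2 ⟨hne, hvF⟩
  rw [← show F.erase v = F.erase w from h] at this
  exact Finset.notMem_erase v F this

theorem image_erase_subset_ridges (hr : r ⊆ F) : r.image F.erase ⊆ ridges F :=
  Finset.image_subset_image hr

theorem isBasicTile_intervalTile (hr : r ⊆ F) (hF : F.Nonempty) :
    ∃ m l, IsBasicTile (intervalTile F r) m l := by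
  have := Finset.card_pos.2 hF
  refine ⟨F.card - 1, _, F, by omega, rfl, r.image F.erase, image_erase_subset_ridges hr, rfl, ?_⟩
  ext c
  rw [mem_below_ridges (image_erase_subset_ridges hr), restSet_image hr]
  simp [intervalTile]

theorem IsBasicTile.eq_intervalTile {m l : ℕ} (h : IsBasicTile S m l) :
    ∃ F r, F.card = m + 1 ∧ r ⊆ F ∧ S = intervalTile F r := by
  obtain ⟨F, hF, hK, R, hR, -, hL⟩ := h
  refine ⟨F, restSet F R, hF, restSet_subset R, ?_⟩
  obtain ⟨K, L⟩ := S
  simp only [intervalTile, RelCplx.mk.injEq]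
  refine ⟨hK, ?_⟩
  simp only at hL
  ext c
  rw [hL, mem_below_ridges hR, Finset.mem_filter, Finset.mem_powerset]

theorem isCriticalTile_intervalTile {m : ℕ} (hr : r ⊆ F) (hF : F.card = m + 1) :
    (∃ l, IsCriticalTile (intervalTile F r) m l) ↔ r = ∅ ∨ r = F := by
  constructor
  · rintro ⟨l, F', hF', hK, ⟨-, hL⟩ | ⟨hl, R, hR, hRl, hL⟩⟩
    · left
      by_contra hr0
      have : ∅ ∈ (intervalTile F r).L := by
        simp [intervalTile, hr0]
      rw [hL] at this
      simp at this
    · right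
      obtain rfl : F = F' := Finset.powerset_injective hK
      have key : ∀ c ⊆ F, r ⊆ c ↔ restSet F R ⊂ c := by
        intro c hc
        have := Finset.ext_iff.1 hL c
        rw [Finset.mem_union, mem_below_ridges hR] at this
        simp only [intervalTile, below, Finset.mem_filter, Finset.mem_powerset, hc, true_and,
          Finset.mem_singleton, exists_eq_left] at this
        rw [Finset.ssubset_def]
        tauto
      have hs : restSet F R ⊂ r := (key r hr).1 subset_rfl
      refine hr.antisymm fun x hx => ?_
      by_cases hxR : x ∈ restSet F R
      · exact hs.1 hxR
      · obtain ⟨y, hyr, hyR⟩ := Finset.exists_of_ssubset hs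
        have h1 := (key (insert x (restSet F R))
          (Finset.insert_subset hx (restSet_subset R))).2 (Finset.ssubset_insert hxR)
        have : x = y := by
          rcases Finset.mem_insert.1 (h1 hyr) with h | h
          · exact h.symm
          · exact absurd h hyR
        exact this ▸ hyr
  · rintro (rfl | rfl)
    · exact ⟨0, F, hF, rfl, Or.inl ⟨rfl, by simp [intervalTile]⟩⟩
    · obtain ⟨x, hx⟩ : r.Nonempty := Finset.card_pos.1 (by omega)
      have hsub : r.erase x ⊆ r := Finset.erase_subset _ _
      have hR := image_erase_subset_ridges hsub
      refine ⟨m, r, hF, rfl, Or.inr ⟨le_rfl, (r.erase x).image r.erase, hR, ?_, ?_⟩⟩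
      · rw [card_restSet hR, restSet_image hsub, Finset.card_erase_of_mem hx]
        omega
      · rw [restSet_image hsub]
        ext c
        rw [Finset.mem_union, mem_below_ridges hR, restSet_image hsub]
        simp only [intervalTile, below, Finset.mem_filter, Finset.mem_powerset,
          Finset.mem_singleton, exists_eq_left, ← and_or_left]
        refine and_congr_right fun hc => ⟨fun h => ?_, ?_⟩
        · by_contra! h'
          refine h fun y hy => ?_
          by_cases hyx : y = x
          · obtain ⟨z, hz, hz'⟩ := Finset.not_subset.1 h'.2
            rw [Finset.mem_erase, not_and] at hz'
            have : z = x := by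
              by_contra hzx
              exact hz' hzx (hc hz)
            exact hyx ▸ this ▸ hz
          · exact h'.1 (Finset.mem_erase.2 ⟨hyx, hy⟩)
        · rintro (h | h) hrc
          · exact h (hsub.trans hrc)
          · exact Finset.notMem_erase x r (h (hrc hx))

theorem exists_isCriticalTile_intervalTile (hr : r ⊆ F) (hF : F.Nonempty) :
    (∃ m l, IsCriticalTile (intervalTile F r) m l) ↔ r = ∅ ∨ r = F := by
  obtain ⟨m, hm⟩ : ∃ m, F.card = m + 1 := ⟨F.card - 1, by have := hF.card_pos; omega⟩
  rw [← isCriticalTile_intervalTile hr hm]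
  refine ⟨?_, fun h => ⟨m, h⟩⟩
  rintro ⟨m', l, h⟩
  obtain ⟨F', hF', hK, -⟩ := id h
  obtain rfl : F = F' := Finset.powerset_injective hK
  obtain rfl : m = m' := by omega
  exact ⟨l, h⟩

theorem isClosedSimplexTile_intervalTile : IsClosedSimplexTile (intervalTile F r) ↔ r = ∅ := by
  constructor
  · rintro ⟨_, -, hL⟩
    by_contra h
    have : ∅ ∈ (intervalTile F r).L := by simp [intervalTile, h]
    rw [hL] at this
    simp at this
  · rintro rfl
    exact ⟨F, rfl, by simp [intervalTile]⟩

theorem isOpenSimplexTile_intervalTile (hr : r ⊆ F) (hF : F.Nonempty) :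
    IsOpenSimplexTile (intervalTile F r) ↔ r = F := by
  constructor
  · rintro ⟨F', hF', hK, hL⟩
    obtain rfl : F = F' := Finset.powerset_injective hK
    by_contra h
    have : r ∈ (intervalTile F r).L := by
      rw [hL]; simp [h, hr]
    simp [intervalTile] at this
  · rintro rfl
    refine ⟨r, hF.ne_empty, rfl, ?_⟩
    ext c
    simp only [intervalTile, Finset.mem_filter, Finset.mem_powerset, Finset.mem_erase]
    rw [and_comm]
    refine and_congr_left fun hc => not_congr ⟨fun h => hc.antisymm h, fun h => h.ge⟩

theorem join_intervalTile {F' r' : Finset V} (hd : Disjoint F F') (hr : r ⊆ F) (hr' : r' ⊆ F') :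
    (intervalTile F r).join (intervalTile F' r') = intervalTile (F ∪ F') (r ∪ r') := by
  have hsplit : ∀ c ⊆ F ∪ F', (c ∩ F) ∪ (c ∩ F') = c := fun c hc => by
    rw [← Finset.inter_union_distrib_left, Finset.inter_eq_left.2 hc]
  have hsub : ∀ {a b : Finset V}, a ⊆ F → b ⊆ F' → (r ∪ r' ⊆ a ∪ b ↔ r ⊆ a ∧ r' ⊆ b) := by
    intro a b ha hb
    constructor
    · intro h
      constructor <;> intro x hx
      · refine (Finset.mem_union.1 (h (Finset.mem_union_left _ hx))).resolve_right fun hxb => ?_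
        exact Finset.disjoint_left.1 hd (hr hx) (hb hxb)
      · refine (Finset.mem_union.1 (h (Finset.mem_union_right _ hx))).resolve_left fun hxa => ?_
        exact Finset.disjoint_left.1 hd (ha hxa) (hr' hx)
    · exact fun h => Finset.union_subset_union h.1 h.2
  simp only [RelCplx.join, intervalTile, RelCplx.mk.injEq]
  constructor
  · ext c
    simp only [joinF, Finset.mem_image, Finset.mem_product, Finset.mem_powerset, Prod.exists]
    constructor
    · rintro ⟨a, b, ⟨ha, hb⟩, rfl⟩
      exact Finset.union_subset_union ha hb
    · intro hc
      exact ⟨c ∩ F, c ∩ F', ⟨Finset.inter_subset_right, Finset.inter_subset_right⟩, hsplit c hc⟩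
  · ext c
    simp only [joinF, Finset.mem_union, Finset.mem_image, Finset.mem_product,
      Finset.mem_powerset, Finset.mem_filter, Prod.exists]
    constructor
    · rintro (⟨a, b, ⟨⟨ha, ha'⟩, hb⟩, rfl⟩ | ⟨a, b, ⟨ha, hb, hb'⟩, rfl⟩)
      · exact ⟨Finset.union_subset_union ha hb, fun h => ha' ((hsub ha hb).1 h).1⟩
      · exact ⟨Finset.union_subset_union ha hb, fun h => hb' ((hsub ha hb).1 h).2⟩
    · rintro ⟨hc, h⟩
      have ha : c ∩ F ⊆ F := Finset.inter_subset_right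
      have hb : c ∩ F' ⊆ F' := Finset.inter_subset_right
      rw [← hsplit c hc, hsub ha hb, not_and_or] at h
      rcases h with h | h
      · exact Or.inl ⟨c ∩ F, c ∩ F', ⟨⟨ha, h⟩, hb⟩, hsplit c hc⟩
      · exact Or.inr ⟨c ∩ F, c ∩ F', ⟨ha, hb, h⟩, hsplit c hc⟩

theorem suppK_intervalTile : suppK (intervalTile F r) = F := by
  refine le_antisymm (Finset.sup_le fun a ha => Finset.mem_powerset.1 ha) ?_
  exact Finset.le_sup (f := id) (Finset.mem_powerset_self F)

theorem mem_sd_powerset {c : Finset (Finset V)} : c ∈ sd F.powerset ↔ IsFlag F c := by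
  rw [sd, if_neg (Finset.powerset_nonempty F).ne_empty]
  simp only [Finset.mem_filter, Finset.mem_powerset]
  constructor
  · rintro ⟨h1, h2⟩ a ha
    have := h1 ha
    rw [Finset.mem_erase, Finset.mem_powerset] at this
    exact ⟨this.1, this.2, h2 a ha⟩
  · intro h
    exact ⟨fun a ha => Finset.mem_erase.2 ⟨(h a ha).1, Finset.mem_powerset.2 (h a ha).2.1⟩,
      fun a ha => (h a ha).2.2⟩

theorem mem_sd_intervalTile_K {c : Finset (Finset V)} :
    c ∈ sd (intervalTile F r).K ↔ IsFlag F c := mem_sd_powerset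

theorem mem_sd_intervalTile_L {c : Finset (Finset V)} :
    c ∈ sd (intervalTile F r).L ↔ IsFlag F c ∧ ¬ Reaches r c := by
  rw [← mem_sd_powerset]
  by_cases hr : r = ∅
  · subst hr
    simp [intervalTile, sd, Reaches]
  · have hne : (intervalTile F r).L ≠ ∅ := by
      refine Finset.ne_empty_of_mem (a := ∅) ?_
      simp [intervalTile, hr]
    rw [sd, if_neg hne, sd, if_neg (Finset.powerset_nonempty F).ne_empty]
    simp only [Finset.mem_filter, Finset.mem_powerset, Reaches, hr, false_or,
      Finset.subset_iff (s₁ := c), intervalTile, Finset.mem_erase, not_exists, not_and]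
    grind

theorem mem_faces_sdR {c : Finset (Finset V)} :
    c ∈ (intervalTile F r).sdR.faces ↔ c ∈ relFlags F r := by
  rw [RelCplx.faces, Finset.mem_sdiff]
  simp only [RelCplx.sdR, mem_sd_intervalTile_L, mem_sd_intervalTile_K]
  exact ⟨fun h => ⟨h.1, not_not.1 fun hr => h.2 ⟨h.1, hr⟩⟩, fun h => ⟨h.1, fun h' => h'.2 h.2⟩⟩

theorem mem_relDerivedNbhd {G s : Finset V} (hG : G ⊆ F) {c : Finset (Finset V)} :
    c ∈ relDerivedNbhd (intervalTile G s) (intervalTile F r) ↔ c ∈ nbhdFlags F r G := by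
  rw [relDerivedNbhd, Finset.mem_inter, mem_faces_sdR, suppK_intervalTile]
  simp only [Finset.mem_biUnion, RelCplx.faces, Finset.mem_sdiff, RelCplx.starR, star,
    Finset.mem_filter]
  simp only [RelCplx.sdR, mem_sd_intervalTile_L, mem_sd_intervalTile_K]
  constructor
  · rintro ⟨⟨v, hv, ⟨hc, hcv⟩, -⟩, -, hr⟩
    refine ⟨hc, hr, v, hv, fun a ha => ?_⟩
    rcases (hcv {v} (by simp)).2.2 a (by simp [ha]) with h | h
    · simpa using h
    · rcases Finset.subset_singleton_iff.1 h with h | h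
      · exact absurd h (hc a ha).1
      · simp [h]
  · rintro ⟨hc, hr, v, hv, h⟩
    refine ⟨⟨v, hv, ⟨hc, ?_⟩, fun h => h.1.2 hr⟩, hc, hr⟩
    intro a ha
    rcases Finset.mem_union.1 ha with ha | ha
    · rw [Finset.mem_singleton] at ha
      subst ha
      refine ⟨by simp, by simpa using hG hv, fun b hb => ?_⟩
      rcases Finset.mem_union.1 hb with hb | hb
      · exact Or.inl (Finset.mem_singleton.1 hb).ge
      · exact Or.inl (Finset.singleton_subset_iff.2 (h b hb))
    · refine ⟨(hc a ha).1, (hc a ha).2.1, fun b hb => ?_⟩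
      rcases Finset.mem_union.1 hb with hb | hb
      · exact Or.inr (Finset.mem_singleton.1 hb ▸ Finset.singleton_subset_iff.2 (h a ha))
      · exact (hc a ha).2.2 b hb

theorem exists_isRelIso_intervalTile {W : Type*} [DecidableEq W] {G s : Finset W}
    (hcard : F.card = G.card) (h : r = ∅ ∧ s = ∅ ∨ r = F ∧ s = G) (hF : F.Nonempty) :
    ∃ f : V → W, IsRelIso f (intervalTile F r) (intervalTile G s) := by
  have hG : G.Nonempty := Finset.card_pos.1 (hcard ▸ hF.card_pos)
  have : Nonempty W := ⟨hG.choose⟩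
  obtain ⟨f, hf⟩ := F.finite_toSet.exists_bijOn_of_encard_eq (t := (G : Set W)) (by simp [hcard])
  have himg : F.image f = G := by
    rw [← Finset.coe_inj, Finset.coe_image, hf.image_eq]
  have hrs : r.image f = s := by
    rcases h with ⟨rfl, rfl⟩ | ⟨rfl, rfl⟩
    · simp
    · exact himg
  have hrF : r ⊆ F := by
    rcases h with ⟨rfl, -⟩ | ⟨rfl, -⟩
    · simp
    · exact subset_rfl
  have hsub : ∀ a ⊆ F, ∀ b ⊆ F, a.image f ⊆ b.image f → a ⊆ b := by
    intro a ha b hb h x hx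
    obtain ⟨y, hy, hxy⟩ := Finset.mem_image.1 (h (Finset.mem_image_of_mem f hx))
    exact hf.injOn (hb hy) (ha hx) hxy ▸ hy
  have hinj : Set.InjOn (fun a : Finset V => a.image f) ↑F.powerset := by
    intro a ha b hb hab
    have ha := Finset.mem_powerset.1 ha
    have hb := Finset.mem_powerset.1 hb
    exact (hsub a ha b hb hab.le).antisymm (hsub b hb a ha hab.ge)
  refine ⟨f, ⟨?_, hinj, ?_⟩, ?_, hinj.mono ?_, ?_⟩
  · intro a ha
    have ha := Finset.mem_powerset.1 ha
    exact Finset.mem_powerset.2 (himg ▸ Finset.image_subset_image ha)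
  · intro b hb
    have hb := Finset.mem_powerset.1 hb
    rw [← himg] at hb
    obtain ⟨a, ha, rfl⟩ := Finset.subset_image_iff.1 hb
    exact ⟨a, Finset.mem_powerset.2 ha, rfl⟩
  · intro a ha
    obtain ⟨ha, hra⟩ := Finset.mem_filter.1 ha
    have ha := Finset.mem_powerset.1 ha
    refine Finset.mem_filter.2 ⟨Finset.mem_powerset.2 (himg ▸ Finset.image_subset_image ha), ?_⟩
    rw [← hrs]
    exact fun h => hra (hsub r hrF a ha h)
  · exact Finset.coe_subset.2 (Finset.filter_subset _ _)
  · intro b hb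
    obtain ⟨hb, hsb⟩ := Finset.mem_filter.1 hb
    have hb := Finset.mem_powerset.1 hb
    rw [← himg] at hb
    obtain ⟨a, ha, rfl⟩ := Finset.subset_image_iff.1 hb
    refine ⟨a, Finset.mem_filter.2 ⟨Finset.mem_powerset.2 ha, fun h => hsb ?_⟩, rfl⟩
    rw [← hrs]
    exact Finset.image_subset_image h

theorem Shells.isFacet {B : Finset V} {D D' : Set (Finset (Finset V))}
    {l : List (Finset (Finset V) × Finset (Finset V))}
    (h : Shells F B D l D') {t : Finset (Finset V) × Finset (Finset V)} (ht : t ∈ l) :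
    t.1 ∈ sd F.powerset ∧ ∀ c ∈ sd F.powerset, t.1 ⊆ c → c = t.1 := by
  obtain ⟨-, hf, hc, -⟩ := h.basic ht
  refine ⟨mem_sd_powerset.2 hf, fun c hc' hsub => ?_⟩
  exact (Finset.eq_of_subset_of_card_le hsub
    (hc ▸ (mem_sd_powerset.1 hc').card_le)).symm

/-- The tiling underlying a shelling by intervals. -/
def tilingOfShells {B : Finset V} {l : List (Finset (Finset V) × Finset (Finset V))}
    (h : Shells F B ∅ l (relFlags F B)) : Tiling (intervalTile F B).sdR l.length where
  tile i := intervalTile l[i].1 l[i].2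
  isFacet i := ⟨l[i].1, (h.isFacet (l.getElem_mem i.2)).1, (h.isFacet (l.getElem_mem i.2)).2, rfl⟩
  subL _ := Finset.filter_subset _ _
  disj i j hij := by
    rw [Finset.disjoint_left]
    intro c hi hj
    have hi : c ∈ tileFaces l[i] := mem_faces_intervalTile.1 hi
    have hj : c ∈ tileFaces l[j] := mem_faces_intervalTile.1 hj
    have hp := List.pairwise_iff_getElem.1 h.pairwise
    rcases lt_or_gt_of_ne hij with hlt | hlt
    · exact Set.disjoint_left.1 (hp i j i.2 j.2 hlt) hi hj
    · exact Set.disjoint_left.1 (hp j i j.2 i.2 hlt) hj hi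
  cover := by
    ext c
    rw [mem_faces_sdR, h.eq_union]
    simp only [Finset.mem_biUnion, Finset.mem_univ, true_and, mem_faces_intervalTile,
      Set.empty_union, Set.mem_ofPred_eq, List.exists_mem_iff_getElem]
    exact ⟨fun ⟨i, hi⟩ => ⟨i, i.2, hi⟩, fun ⟨i, hi, h⟩ => ⟨⟨i, hi⟩, h⟩⟩

theorem mem_prefixFaces_tilingOfShells {B : Finset V}
    {l : List (Finset (Finset V) × Finset (Finset V))}
    (h : Shells F B ∅ l (relFlags F B)) {p : ℕ} (hp : p ≤ l.length) {c : Finset (Finset V)} :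
    c ∈ (tilingOfShells h).prefixFaces p ↔ ∃ t ∈ l.take p, c ∈ tileFaces t := by
  simp only [Tiling.prefixFaces, Finset.mem_biUnion, Finset.mem_filter, Finset.mem_univ,
    true_and, List.exists_mem_iff_getElem, List.length_take, List.getElem_take, tilingOfShells,
    mem_faces_intervalTile]
  exact ⟨fun ⟨i, hi, h⟩ => ⟨i, by omega, h⟩, fun ⟨i, hi, h⟩ => ⟨⟨i, by omega⟩, by simp; omega, h⟩⟩

theorem isShelling_tilingOfShells {B : Finset V}
    {l : List (Finset (Finset V) × Finset (Finset V))}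
    (h : Shells F B ∅ l (relFlags F B)) : (tilingOfShells h).IsShelling := by
  intro p hp c hc d hd
  obtain ⟨D, hD, -⟩ := Shells.split (l := l.take p) (l' := l.drop p)
    (by rwa [List.take_append_drop])
  have hmem : ∀ c, c ∈ (tilingOfShells h).prefixFaces p ↔ c ∈ D := fun c => by
    rw [mem_prefixFaces_tilingOfShells h hp, hD.eq_union]
    simp
  have hflag : IsFlag F c ∧ (Reaches B c → c ∈ D) := by
    rcases Finset.mem_union.1 hc with hc | hc
    · have := mem_sd_intervalTile_L.1 hc
      exact ⟨this.1, fun h => absurd h this.2⟩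
    · obtain ⟨t, ht, hct⟩ := (mem_prefixFaces_tilingOfShells h hp).1 hc
      exact ⟨(hD.basic ht).2.1.mono hct.2, fun _ => (hmem c).1 hc⟩
  rw [Finset.mem_union, hmem]
  by_cases hB : Reaches B d
  · exact Or.inr (hD.closed (by simp) c (hflag.2 (hB.mono hd)) d hd hB)
  · exact Or.inl (mem_sd_intervalTile_L.2 ⟨hflag.1.mono hd, hB⟩)

end IntervalTile

/-- **Theorem (second case).** Let `T`, `T'` be nonempty basic tiles on disjoint
vertex sets such that it is not the case that `T` is an open simplex and `T'` a
closed one. Then `sd(T * T')` carries a shelled h-tiling beginning with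
`N(T, T * T')`, using a critical tile iff `T * T'` is critical; this critical
tile is then unique, isomorphic to `T * T'`, contained in `N(T, T * T')` if
`T * T'` is a closed simplex and disjoint from it if `T * T'` is an open one. -/
theorem h_tiling_of_sd_join_of_basic_tiles
    {V : Type*} [DecidableEq V] (T T' : RelCplx V) (n k n' k' : ℕ)
    (hT : IsBasicTile T n k) (hT' : IsBasicTile T' n' k')
    (hd : Disjoint (suppK T) (suppK T'))
    (hnot : ¬ (IsOpenSimplexTile T ∧ IsClosedSimplexTile T')) :
    ∃ (N : ℕ) (Tl : Tiling ((T.join T').sdR) N),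
      Tl.IsH ∧ Tl.IsShelling ∧
      Tl.BeginsWith (relDerivedNbhd T (T.join T')) ∧
      ((∃ i : Fin N, ∃ m l, IsCriticalTile (Tl.tile i) m l) ↔
        ∃ l, IsCriticalTile (T.join T') (n + n' + 1) l) ∧
      ∀ i : Fin N, (∃ m l, IsCriticalTile (Tl.tile i) m l) →
        ((∀ j : Fin N, (∃ m l, IsCriticalTile (Tl.tile j) m l) → j = i) ∧
          (∃ f : V → Finset V, IsRelIso f (T.join T') (Tl.tile i)) ∧
          (IsClosedSimplexTile (T.join T') →
            (Tl.tile i).faces ⊆ relDerivedNbhd T (T.join T')) ∧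
          (IsOpenSimplexTile (T.join T') →
            Disjoint (Tl.tile i).faces (relDerivedNbhd T (T.join T')))) := by
  obtain ⟨F, r, hF, hr, rfl⟩ := hT.eq_intervalTile
  obtain ⟨F', r', hF', hr', rfl⟩ := hT'.eq_intervalTile
  rw [suppK_intervalTile, suppK_intervalTile] at hd
  have hFn : F.Nonempty := Finset.card_pos.1 (by omega)
  have hFn' : F'.Nonempty := Finset.card_pos.1 (by omega)
  rw [isOpenSimplexTile_intervalTile hr hFn, isClosedSimplexTile_intervalTile] at hnot
  rw [join_intervalTile hd hr hr']
  have hcard : (F ∪ F').card = n + n' + 1 + 1 := by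
    rw [Finset.card_union_of_disjoint hd]; omega
  have hne : F ≠ F ∪ F' := fun h => by
    have := congrArg Finset.card h
    omega
  have hcond : F = r ∪ r' → F = ∅ ∨ F = F ∪ F' := by
    intro h
    refine absurd ⟨?_, ?_⟩ hnot
    · refine hr.antisymm fun x hx => ?_
      refine (Finset.mem_union.1 (h ▸ hx)).resolve_right fun hx' => ?_
      exact Finset.disjoint_left.1 hd hx (hr' hx')
    · refine Finset.eq_empty_of_forall_notMem fun x hx => ?_
      exact Finset.disjoint_left.1 hd (h ▸ Finset.mem_union_right _ hx) (hr' hx)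
  have hrX : r ∪ r' ⊆ F ∪ F' := Finset.union_subset_union hr hr'
  have hFX : F ⊆ F ∪ F' := Finset.subset_union_left
  generalize hX : F ∪ F' = X at *
  generalize r ∪ r' = B at *
  have hXn : X.Nonempty := hFn.mono hFX
  obtain ⟨l₁, l₂, hl₁, hl₂, hfull, hfull₁, huniq, hex⟩ := hasShelling hXn hrX hFX hcond
  have hl := hl₁.append hl₂
  have hget : ∀ i : Fin (l₁ ++ l₂).length, (l₁ ++ l₂)[i] ∈ l₁ ++ l₂ :=
    fun i => List.getElem_mem i.2
  have hcrit : ∀ i, (∃ m l, IsCriticalTile ((tilingOfShells hl).tile i) m l) ↔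
      (l₁ ++ l₂)[i].2 = ∅ ∨ (l₁ ++ l₂)[i].2 = (l₁ ++ l₂)[i].1 := by
    intro i
    have hb := hl.basic (hget i)
    exact exists_isCriticalTile_intervalTile hb.1
      (Finset.card_pos.1 (hb.2.2.1 ▸ hXn.card_pos))
  have hempty : ∀ i : Fin (l₁ ++ l₂).length, (l₁ ++ l₂)[i].2 = ∅ → B = ∅ := by
    intro i h
    have := (hl.basic (hget i)).2.2.2
    rw [h] at this
    simpa [Reaches] using this
  have heq : ∀ i j : Fin (l₁ ++ l₂).length, ∀ c ∈ tileFaces (l₁ ++ l₂)[i], c ∈ tileFaces (l₁ ++ l₂)[j] → i = j := by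
    intro i j c hi hj
    by_contra hij
    exact Finset.disjoint_left.1 ((tilingOfShells hl).disj i j hij)
      (mem_faces_intervalTile.2 hi) (mem_faces_intervalTile.2 hj)
  refine ⟨_, tilingOfShells hl, ?_, isShelling_tilingOfShells hl, ⟨l₁.length, by simp, ?_⟩, ?_, ?_⟩
  · intro i
    have hb := hl.basic (hget i)
    exact Or.inl (isBasicTile_intervalTile hb.1 (Finset.card_pos.1 (hb.2.2.1 ▸ hXn.card_pos)))
  · ext c
    rw [mem_prefixFaces_tilingOfShells hl (by simp), mem_relDerivedNbhd hFX, hl₁.eq_union]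
    simp
  · simp only [hcrit]
    rw [isCriticalTile_intervalTile hrX hcard]
    constructor
    · rintro ⟨i, h | h⟩
      · exact Or.inl (hempty i h)
      · exact Or.inr (hfull _ (hget i) h)
    · rintro (h | h)
      · have hmem : ∅ ∈ relFlags X B := ⟨fun a ha => by simp at ha, Or.inl h⟩
        rw [hl.eq_union] at hmem
        obtain ⟨t, ht, hc⟩ := hmem.resolve_left id
        obtain ⟨i, hi, rfl⟩ := List.getElem_of_mem ht
        exact ⟨⟨i, hi⟩, Or.inl (Finset.subset_empty.1 hc.1)⟩
      · obtain ⟨t, ht, hc⟩ := hex h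
        obtain ⟨i, hi, rfl⟩ := List.getElem_of_mem ht
        exact ⟨⟨i, hi⟩, Or.inr hc⟩
  · intro i hi
    rw [hcrit] at hi
    have hb := hl.basic (hget i)
    have hcases : B = ∅ ∧ (l₁ ++ l₂)[i].2 = ∅ ∨ B = X ∧ (l₁ ++ l₂)[i].2 = (l₁ ++ l₂)[i].1 :=
      hi.imp (fun h => ⟨hempty i h, h⟩) (fun h => ⟨hfull _ (hget i) h, h⟩)
    refine ⟨fun j hj => ?_, exists_isRelIso_intervalTile hb.2.2.1.symm hcases hXn,
      fun hc c hct => ?_, fun ho => Finset.disjoint_left.2 fun c hct => ?_⟩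
    · rw [hcrit] at hj
      rcases hcases with ⟨hB, hi⟩ | ⟨hB, hi⟩
      · have hj : (l₁ ++ l₂)[j].2 = ∅ := hj.resolve_right fun h =>
          hXn.ne_empty ((hfull _ (hget j) h).symm.trans hB)
        exact heq j i ∅ ⟨hj.le, Finset.empty_subset _⟩ ⟨hi.le, Finset.empty_subset _⟩
      · have hj : (l₁ ++ l₂)[j].2 = (l₁ ++ l₂)[j].1 := hj.resolve_left fun h =>
          hXn.ne_empty (hB.symm.trans (hempty j h))
        have hij := huniq _ (hget j) _ (hget i) hj hi
        exact heq j i _ (hl.top_mem (hget j)) (by rw [hij]; exact hl.top_mem (hget i))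
    · rw [isClosedSimplexTile_intervalTile] at hc
      have hi := (hcases.resolve_right fun h => hXn.ne_empty (h.1.symm.trans hc)).2
      rw [mem_relDerivedNbhd hFX]
      rcases List.mem_append.1 (hget i) with h | h
      · exact hl₁.mem h (mem_faces_intervalTile.1 hct)
      · refine absurd ?_ (hl₂.notMem h (c := ∅) ⟨hi.le, Finset.empty_subset _⟩)
        exact ⟨fun a ha => by simp at ha, Or.inl hc, hFn.choose, hFn.choose_spec,
          fun a ha => by simp at ha⟩
    · rw [isOpenSimplexTile_intervalTile hrX hXn] at ho
      have hi := (hcases.resolve_left fun h => hXn.ne_empty (ho.symm.trans h.1)).2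
      rw [mem_relDerivedNbhd hFX]
      rcases List.mem_append.1 (hget i) with h | h
      · exact absurd (hfull₁ _ h hi) hne
      · exact hl₂.notMem h (mem_faces_intervalTile.1 hct)

end MorseShelling
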